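/- Let q ∈ ℝ with 0 < q < 1 and let x ∈ ℂ be such that x² is not a nonnegative real number. Then the map c ↦ T(x;c) from ℝ to ℂ is defined in a neighbourhood of c = −2, is differentiable at c = −2, and its derivative at c = −2 equals f(x). (This is the structure function of the natural Poisson bracket {t(z),t(w)} on the center of 𝒜_{q,p}(ŝl(2)_c) at the critical level c = −2, with x = z/w.) -/

import Mathlib

open scoped BigOperators

/-- The infinite `q`-Pochhammer-type product `(x;t)_∞ = ∏_{n=0}^∞ (1 - x tⁿ)`. -/
noncomputable def qPoch (x t : ℂ) : ℂ := ∏' n : ℕ, (1 - x * t ^ n)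

/-- The theta function `Θ_t(x) = (x;t)_∞ (t x⁻¹;t)_∞ (t;t)_∞`. -/
noncomputable def Theta (t x : ℂ) : ℂ := qPoch x t * qPoch (t * x⁻¹) t * qPoch t t

/-- The function `τ(y) = y⁻¹ Θ_{q⁴}(q y²) / Θ_{q⁴}(q y⁻²)`. -/
noncomputable def tauf (q y : ℂ) : ℂ :=
  y⁻¹ * Theta (q ^ 4) (q * y ^ 2) / Theta (q ^ 4) (q * y⁻¹ ^ 2)

/-- The prefactor `T(x;c)` of the exchange of `t(z)` with `t(w)` near the critical level. -/
noncomputable def Tfun (q : ℝ) (x : ℂ) (c : ℝ) : ℂ :=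
  tauf q ((q ^ ((1 : ℝ) / 2) : ℝ) * x) * tauf q ((q ^ (-c + 1 / 2) : ℝ) * x⁻¹) /
    (tauf q ((q ^ (-c - 3 / 2) : ℝ) * x) * tauf q ((q ^ ((1 : ℝ) / 2) : ℝ) * x⁻¹))

/-- The structure function `f(x)` of the Poisson bracket `{t(z),t(w)}` at `c = -2`. -/
noncomputable def ffun (q : ℝ) (x : ℂ) : ℂ :=
  -2 * (Real.log q : ℂ) *
    ((∑' n : ℕ,
        (2 * x ^ 2 * (q : ℂ) ^ (4 * n + 2) / (1 - x ^ 2 * (q : ℂ) ^ (4 * n + 2)) -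
          2 * x⁻¹ ^ 2 * (q : ℂ) ^ (4 * n + 2) / (1 - x⁻¹ ^ 2 * (q : ℂ) ^ (4 * n + 2)))) +
      (∑' n : ℕ,
        (-(2 * x ^ 2 * (q : ℂ) ^ (4 * (n + 1))) / (1 - x ^ 2 * (q : ℂ) ^ (4 * (n + 1))) +
          2 * x⁻¹ ^ 2 * (q : ℂ) ^ (4 * (n + 1)) / (1 - x⁻¹ ^ 2 * (q : ℂ) ^ (4 * (n + 1))))) -
      x ^ 2 / (1 - x ^ 2) + x⁻¹ ^ 2 / (1 - x⁻¹ ^ 2))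

/-- The Lambert-type series `∑_{n=0}^∞ x tⁿ / (1 - x tⁿ)`. -/
noncomputable def qLambert (x t : ℂ) : ℂ := ∑' n : ℕ, x * t ^ n / (1 - x * t ^ n)

/-- `F` has logarithmic derivative `l` at `c`. -/
def HasLogDerivAt (F : ℝ → ℂ) (l : ℂ) (c : ℝ) : Prop := HasDerivAt F (F c * l) c

namespace HasLogDerivAt

variable {F G : ℝ → ℂ} {l m : ℂ} {c : ℝ}

lemma const_mul (a : ℂ) (hF : HasLogDerivAt F l c) : HasLogDerivAt (fun c => a * F c) l c := by
  simpa [HasLogDerivAt, mul_assoc] using HasDerivAt.const_mul a hF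

lemma mul (hF : HasLogDerivAt F l c) (hG : HasLogDerivAt G m c) :
    HasLogDerivAt (fun c => F c * G c) (l + m) c := by
  unfold HasLogDerivAt at *
  exact (HasDerivAt.fun_mul hF hG).congr_deriv (by ring)

lemma inv (hF : HasLogDerivAt F l c) (h0 : F c ≠ 0) : HasLogDerivAt (fun c => (F c)⁻¹) (-l) c := by
  unfold HasLogDerivAt at *
  exact (HasDerivAt.fun_inv hF h0).congr_deriv (by field_simp)

lemma div (hF : HasLogDerivAt F l c) (hG : HasLogDerivAt G m c) (h0 : G c ≠ 0) :
    HasLogDerivAt (fun c => F c / G c) (l - m) c := by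
  simpa only [div_eq_mul_inv, sub_eq_add_neg] using hF.mul (hG.inv h0)

lemma pow_two (hF : HasLogDerivAt F l c) : HasLogDerivAt (fun c => F c ^ 2) (2 * l) c := by
  simpa only [sq, two_mul] using hF.mul hF

end HasLogDerivAt

section qPoch

variable {t x : ℂ}

lemma summable_norm_mul_pow (ht : ‖t‖ < 1) (x : ℂ) : Summable fun n : ℕ => ‖-(x * t ^ n)‖ := by
  simpa using (summable_geometric_of_lt_one (norm_nonneg t) ht).mul_left ‖x‖

lemma multipliable_qPoch (ht : ‖t‖ < 1) (x : ℂ) : Multipliable fun n : ℕ => 1 - x * t ^ n := by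
  simpa only [sub_eq_add_neg] using multipliable_one_add_of_summable (summable_norm_mul_pow ht x)

lemma qPoch_ne_zero (ht : ‖t‖ < 1) (hx : ∀ n : ℕ, 1 - x * t ^ n ≠ 0) : qPoch x t ≠ 0 := by
  have := tprod_one_add_ne_zero_of_summable (f := fun n : ℕ => -(x * t ^ n))
    (by simpa only [← sub_eq_add_neg] using hx) (summable_norm_mul_pow ht x)
  simpa only [qPoch, sub_eq_add_neg] using this

lemma qPoch_eq_one_sub_mul (ht : ‖t‖ < 1) (x : ℂ) :
    qPoch x t = (1 - x) * qPoch (t * x) t := by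
  have h (n : ℕ) : 1 - x * t ^ (n + 1) = 1 - t * x * t ^ n := by ring
  have hm : Multipliable fun n : ℕ => 1 - x * t ^ (n + 1) := by
    simpa only [h] using multipliable_qPoch ht (t * x)
  have := tprod_eq_zero_mul' (f := fun n : ℕ => 1 - x * t ^ n) hm
  simpa only [qPoch, h, pow_zero, mul_one] using this

lemma summable_mul_pow_div (ht : ‖t‖ < 1) (x : ℂ) :
    Summable fun n : ℕ => x * t ^ n / (1 - x * t ^ n) := by
  have hs : Summable fun n : ℕ => ‖x * t ^ n‖ := by simpa using summable_norm_mul_pow ht x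
  refine (hs.mul_left 2).of_norm_bounded_eventually ?_
  filter_upwards [hs.tendsto_cofinite_zero.eventually_le_const one_half_pos] with n hn
  have h1 : 1 / 2 ≤ ‖1 - x * t ^ n‖ := by
    have := norm_sub_norm_le (1 : ℂ) (x * t ^ n)
    rw [norm_one] at this
    linarith
  rw [norm_div, div_le_iff₀ (by linarith)]
  nlinarith [norm_nonneg (x * t ^ n)]

lemma qLambert_eq_add (ht : ‖t‖ < 1) (x : ℂ) :
    qLambert x t = x / (1 - x) + qLambert (t * x) t := by
  rw [qLambert, (summable_mul_pow_div ht x).tsum_eq_zero_add, qLambert]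
  simp only [pow_zero, mul_one]
  congr 1
  exact tsum_congr fun n => by ring_nf

lemma multipliableLocallyUniformlyOn_qPoch (ht : ‖t‖ < 1) (R : ℝ) :
    MultipliableLocallyUniformlyOn (fun (n : ℕ) (z : ℂ) => 1 - z * t ^ n) (Metric.ball 0 R) := by
  simp only [sub_eq_add_neg]
  refine Summable.multipliableLocallyUniformlyOn_nat_one_add Metric.isOpen_ball
    ((summable_geometric_of_lt_one (norm_nonneg t) ht).mul_left R)
    (.of_forall fun n z hz => ?_) fun n => by fun_prop
  simp only [norm_neg, norm_mul, norm_pow]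
  gcongr
  exact (mem_ball_zero_iff.mp hz).le

lemma differentiable_qPoch (ht : ‖t‖ < 1) : Differentiable ℂ fun z => qPoch z t := fun z =>
  ((multipliableLocallyUniformlyOn_qPoch ht (‖z‖ + 1)).hasProdLocallyUniformlyOn.differentiableOn
    (.of_forall fun _ => by
      simpa [Finset.prod_fn] using DifferentiableOn.finsetProd fun _ _ => by fun_prop)
    Metric.isOpen_ball).differentiableAt (Metric.isOpen_ball.mem_nhds (by simp))

lemma mul_logDeriv_qPoch (ht : ‖t‖ < 1) (hx : ∀ n : ℕ, 1 - x * t ^ n ≠ 0) :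
    x * logDeriv (fun z => qPoch z t) x = -qLambert x t := by
  have hterm (n : ℕ) : logDeriv (fun z : ℂ => 1 - z * t ^ n) x = -t ^ n / (1 - x * t ^ n) := by
    have : HasDerivAt (fun z : ℂ => 1 - z * t ^ n) (-t ^ n) x := by
      simpa using ((hasDerivAt_id x).mul_const (t ^ n)).const_sub 1
    rw [logDeriv_apply, this.deriv]
  have hmul (n : ℕ) : x * (-t ^ n / (1 - x * t ^ n)) = -(x * t ^ n / (1 - x * t ^ n)) := by ring
  by_cases hx0 : x = 0
  · simp [hx0, qLambert]
  have hs : Summable fun n : ℕ => -t ^ n / (1 - x * t ^ n) := by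
    rw [← summable_mul_left_iff hx0]
    simpa only [hmul] using (summable_mul_pow_div ht x).neg
  have := logDeriv_tprod_eq_tsum Metric.isOpen_ball (x := x) (s := Metric.ball 0 (‖x‖ + 1))
    (by simp) hx (fun n => by fun_prop) (by simpa only [hterm] using hs)
    (multipliableLocallyUniformlyOn_qPoch ht _) (qPoch_ne_zero ht hx)
  simp only [hterm] at this
  simp only [qPoch]
  rw [this, ← tsum_mul_left, qLambert, ← tsum_neg]
  exact tsum_congr hmul

lemma HasLogDerivAt.qPoch {F : ℝ → ℂ} {l : ℂ} {c : ℝ} (hF : HasLogDerivAt F l c) (ht : ‖t‖ < 1)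
    (hx : ∀ n : ℕ, 1 - F c * t ^ n ≠ 0) :
    HasLogDerivAt (fun c => qPoch (F c) t) (-qLambert (F c) t * l) c := by
  have h := (differentiable_qPoch ht (F c)).hasDerivAt.scomp c hF
  have h0 := qPoch_ne_zero ht hx
  unfold HasLogDerivAt
  refine h.congr_deriv ?_
  rw [← mul_logDeriv_qPoch ht hx, logDeriv_apply, smul_eq_mul]
  field_simp

lemma Theta_ne_zero (ht : ‖t‖ < 1) (hx : ∀ n : ℕ, 1 - x * t ^ n ≠ 0)
    (hx' : ∀ n : ℕ, 1 - t * x⁻¹ * t ^ n ≠ 0) : Theta t x ≠ 0 := by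
  refine mul_ne_zero (mul_ne_zero (qPoch_ne_zero ht hx) (qPoch_ne_zero ht hx'))
    (qPoch_ne_zero ht fun n h => ?_)
  have : ‖t ^ (n + 1)‖ < 1 := by
    rw [norm_pow]
    exact pow_lt_one₀ (norm_nonneg t) ht n.succ_ne_zero
  rw [pow_succ', ← sub_eq_zero.mp h, norm_one] at this
  exact lt_irrefl _ this

lemma HasLogDerivAt.Theta {F : ℝ → ℂ} {l : ℂ} {c : ℝ} (hF : HasLogDerivAt F l c) (ht : ‖t‖ < 1)
    (h0 : F c ≠ 0) (hx : ∀ n : ℕ, 1 - F c * t ^ n ≠ 0)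
    (hx' : ∀ n : ℕ, 1 - t * (F c)⁻¹ * t ^ n ≠ 0) :
    HasLogDerivAt (fun c => Theta t (F c))
      ((qLambert (t * (F c)⁻¹) t - qLambert (F c) t) * l) c := by
  have h := ((hF.qPoch ht hx).mul (((hF.inv h0).const_mul t).qPoch ht hx')).const_mul
    (_root_.qPoch t t)
  simp only [_root_.Theta]
  convert h using 1
  · ext c
    ring
  · ring

/-- Quasi-periodicity of the theta function. -/
lemma Theta_mul_self (ht : ‖t‖ < 1) (ht0 : t ≠ 0) (hx0 : x ≠ 0) :
    Theta t (t * x) = -x⁻¹ * Theta t x := by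
  have h1 := qPoch_eq_one_sub_mul ht x
  have h2 := qPoch_eq_one_sub_mul ht x⁻¹
  have h3 : t * (t * x)⁻¹ = x⁻¹ := by field_simp
  rw [Theta, Theta, h3, h2, h1]
  field_simp
  ring

end qPoch

section tauf

variable {q : ℝ} {y : ℂ}

lemma one_sub_mul_pow_ne_zero (hq0 : 0 < q) {z : ℂ} (hz : ∀ r : ℝ, 0 ≤ r → z ≠ r) (n : ℕ) :
    1 - z * ((q : ℂ) ^ 4) ^ n ≠ 0 := fun h => by
  refine hz ((q ^ 4) ^ n)⁻¹ (by positivity) ?_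
  have : ((q : ℂ) ^ 4) ^ n ≠ 0 := by
    have : (q : ℂ) ≠ 0 := by exact_mod_cast hq0.ne'
    positivity
  push_cast
  rw [← mul_eq_one_iff_eq_inv₀ this]
  exact (sub_eq_zero.mp h).symm

lemma inv_ne_ofReal {z : ℂ} (hz : ∀ r : ℝ, 0 ≤ r → z ≠ r) (r : ℝ) (hr : 0 ≤ r) : z⁻¹ ≠ r :=
  fun h => hz r⁻¹ (by positivity) (by rw [Complex.ofReal_inv, ← h, inv_inv])

lemma ofReal_mul_ne_ofReal {z : ℂ} (hz : ∀ r : ℝ, 0 ≤ r → z ≠ r) {a : ℝ} (ha : 0 < a) (r : ℝ)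
    (hr : 0 ≤ r) : a * z ≠ r := fun h => hz (r / a) (by positivity) (by
  have : (a : ℂ) ≠ 0 := by exact_mod_cast ha.ne'
  rw [Complex.ofReal_div, ← h]
  field_simp)

lemma norm_ofReal_pow_lt_one (hq0 : 0 < q) (hq1 : q < 1) : ‖(q : ℂ) ^ 4‖ < 1 := by
  rw [norm_pow, Complex.norm_real, Real.norm_of_nonneg hq0.le]
  exact pow_lt_one₀ hq0.le hq1 (by norm_num)

lemma one_sub_Theta_arg_ne_zero (hq0 : 0 < q) {z : ℂ} (hz : ∀ r : ℝ, 0 ≤ r → z ≠ r) (n : ℕ) :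
    1 - (q : ℂ) ^ 4 * z⁻¹ * ((q : ℂ) ^ 4) ^ n ≠ 0 := by
  have h := ofReal_mul_ne_ofReal (inv_ne_ofReal hz) (pow_pos hq0 4)
  push_cast at h
  exact one_sub_mul_pow_ne_zero hq0 h n

lemma tauf_ne_zero (hq0 : 0 < q) (hq1 : q < 1) (hy : ∀ r : ℝ, 0 ≤ r → y ^ 2 ≠ r) :
    tauf q y ≠ 0 := by
  have ht := norm_ofReal_pow_lt_one hq0 hq1
  have hy' : ∀ r : ℝ, 0 ≤ r → y⁻¹ ^ 2 ≠ r := by simpa only [inv_pow] using inv_ne_ofReal hy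
  have hy0 : y ≠ 0 := by
    rintro rfl
    exact hy 0 le_rfl (by simp)
  have h1 := ofReal_mul_ne_ofReal hy hq0
  have h2 := ofReal_mul_ne_ofReal hy' hq0
  exact div_ne_zero (mul_ne_zero (inv_ne_zero hy0)
    (Theta_ne_zero ht (one_sub_mul_pow_ne_zero hq0 h1) (one_sub_Theta_arg_ne_zero hq0 h1)))
    (Theta_ne_zero ht (one_sub_mul_pow_ne_zero hq0 h2) (one_sub_Theta_arg_ne_zero hq0 h2))

/-- The function `τ` is periodic under `y ↦ q² y`. -/
lemma tauf_sq_mul (hq0 : 0 < q) (hq1 : q < 1) (hy : ∀ r : ℝ, 0 ≤ r → y ^ 2 ≠ r) :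
    tauf q ((q : ℂ) ^ 2 * y) = tauf q y := by
  have ht := norm_ofReal_pow_lt_one hq0 hq1
  have hqc : (q : ℂ) ≠ 0 := by exact_mod_cast hq0.ne'
  have hy0 : y ≠ 0 := by
    rintro rfl
    exact hy 0 le_rfl (by simp)
  have hy' : ∀ r : ℝ, 0 ≤ r → y⁻¹ ^ 2 ≠ r := by simpa only [inv_pow] using inv_ne_ofReal hy
  have e1 := Theta_mul_self ht (pow_ne_zero 4 hqc) (x := q * y ^ 2) (by positivity)
  have e2 := Theta_mul_self ht (pow_ne_zero 4 hqc) (x := ((q ^ 3)⁻¹ : ℝ) * y⁻¹ ^ 2)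
    (by push_cast; positivity)
  have a1 : (q : ℂ) * (q ^ 2 * y) ^ 2 = q ^ 4 * (q * y ^ 2) := by ring
  have a2 : (q : ℂ) * (q ^ 2 * y)⁻¹ ^ 2 = ((q ^ 3)⁻¹ : ℝ) * y⁻¹ ^ 2 := by
    push_cast
    field_simp
  have a3 : (q : ℂ) ^ 4 * (((q ^ 3)⁻¹ : ℝ) * y⁻¹ ^ 2) = q * y⁻¹ ^ 2 := by
    push_cast
    field_simp
  have h2 := ofReal_mul_ne_ofReal hy' (inv_pos.mpr (pow_pos hq0 3))
  have hne := Theta_ne_zero ht (one_sub_mul_pow_ne_zero hq0 h2) (one_sub_Theta_arg_ne_zero hq0 h2)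
  rw [a3] at e2
  rw [tauf, tauf, a1, a2, e1, e2]
  generalize Theta _ (((q ^ 3)⁻¹ : ℝ) * y⁻¹ ^ 2) = B at *
  generalize Theta _ _ = A
  push_cast
  field_simp

lemma HasLogDerivAt.tauf {F : ℝ → ℂ} {l : ℂ} {c : ℝ} (hF : HasLogDerivAt F l c) (hq0 : 0 < q)
    (hq1 : q < 1) (hy : ∀ r : ℝ, 0 ≤ r → F c ^ 2 ≠ r) :
    HasLogDerivAt (fun c => tauf q (F c))
      (l * (-1 + 2 * (qLambert (q ^ 3 * (F c)⁻¹ ^ 2) (q ^ 4) - qLambert (q * F c ^ 2) (q ^ 4)) +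
        2 * (qLambert (q ^ 3 * F c ^ 2) (q ^ 4) - qLambert (q * (F c)⁻¹ ^ 2) (q ^ 4)))) c := by
  have ht := norm_ofReal_pow_lt_one hq0 hq1
  have hqc : (q : ℂ) ≠ 0 := by exact_mod_cast hq0.ne'
  have hy' : ∀ r : ℝ, 0 ≤ r → (F c)⁻¹ ^ 2 ≠ r := by simpa only [inv_pow] using inv_ne_ofReal hy
  have hy0 : F c ≠ 0 := fun h => hy 0 le_rfl (by simp [h])
  have h1 := ofReal_mul_ne_ofReal hy hq0
  have h2 := ofReal_mul_ne_ofReal hy' hq0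
  have d1 := (hF.pow_two.const_mul q).Theta ht (by positivity) (one_sub_mul_pow_ne_zero hq0 h1)
    (one_sub_Theta_arg_ne_zero hq0 h1)
  have d2 := ((hF.inv hy0).pow_two.const_mul q).Theta ht (by positivity)
    (one_sub_mul_pow_ne_zero hq0 h2) (one_sub_Theta_arg_ne_zero hq0 h2)
  have d := ((hF.inv hy0).mul d1).div d2
    (Theta_ne_zero ht (one_sub_mul_pow_ne_zero hq0 h2) (one_sub_Theta_arg_ne_zero hq0 h2))
  have b1 : (q : ℂ) ^ 4 * (q * F c ^ 2)⁻¹ = q ^ 3 * (F c)⁻¹ ^ 2 := by field_simp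
  have b2 : (q : ℂ) ^ 4 * (q * (F c)⁻¹ ^ 2)⁻¹ = q ^ 3 * F c ^ 2 := by field_simp
  rw [b1, b2] at d
  simp only [_root_.tauf]
  convert d using 1
  ring

end tauf

lemma hasLogDerivAt_rpow {q : ℝ} (hq0 : 0 < q) (b c : ℝ) :
    HasLogDerivAt (fun c : ℝ => ((q ^ (-c - b) : ℝ) : ℂ)) (-Real.log q) c := by
  have h := (((hasDerivAt_id c).neg.sub_const b).const_rpow hq0).ofReal_comp
  unfold HasLogDerivAt
  refine h.congr_deriv ?_
  push_cast
  simp only [Pi.neg_apply, id]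
  ring

lemma ffun_eq_qLambert {q : ℝ} (hq0 : 0 < q) (hq1 : q < 1) (x : ℂ) :
    ffun q x = -2 * Real.log q *
      (2 * qLambert (q ^ 2 * x ^ 2) (q ^ 4) - 2 * qLambert (q ^ 2 * x⁻¹ ^ 2) (q ^ 4) -
        2 * qLambert (q ^ 4 * x ^ 2) (q ^ 4) + 2 * qLambert (q ^ 4 * x⁻¹ ^ 2) (q ^ 4) -
        x ^ 2 / (1 - x ^ 2) + x⁻¹ ^ 2 / (1 - x⁻¹ ^ 2)) := by
  have ht := norm_ofReal_pow_lt_one hq0 hq1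
  have s (z : ℂ) := (summable_mul_pow_div ht z).hasSum.mul_left 2
  have h1 := ((s (q ^ 2 * x ^ 2)).sub (s (q ^ 2 * x⁻¹ ^ 2))).tsum_eq
  have h2 := ((s (q ^ 4 * x⁻¹ ^ 2)).sub (s (q ^ 4 * x ^ 2))).tsum_eq
  have e1 (z : ℂ) (n : ℕ) : (q : ℂ) ^ 2 * z * ((q : ℂ) ^ 4) ^ n = z * (q : ℂ) ^ (4 * n + 2) := by
    ring
  have e2 (z : ℂ) (n : ℕ) : (q : ℂ) ^ 4 * z * ((q : ℂ) ^ 4) ^ n = z * (q : ℂ) ^ (4 * (n + 1)) := by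
    ring
  change _ = 2 * qLambert _ _ - 2 * qLambert _ _ at h1 h2
  simp only [e1, e2] at h1 h2
  have h1' : (∑' n : ℕ,
        (2 * x ^ 2 * (q : ℂ) ^ (4 * n + 2) / (1 - x ^ 2 * (q : ℂ) ^ (4 * n + 2)) -
          2 * x⁻¹ ^ 2 * (q : ℂ) ^ (4 * n + 2) / (1 - x⁻¹ ^ 2 * (q : ℂ) ^ (4 * n + 2)))) =
      2 * qLambert (q ^ 2 * x ^ 2) (q ^ 4) - 2 * qLambert (q ^ 2 * x⁻¹ ^ 2) (q ^ 4) := by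
    rw [← h1]
    exact tsum_congr fun n => by ring
  have h2' : (∑' n : ℕ,
        (-(2 * x ^ 2 * (q : ℂ) ^ (4 * (n + 1))) / (1 - x ^ 2 * (q : ℂ) ^ (4 * (n + 1))) +
          2 * x⁻¹ ^ 2 * (q : ℂ) ^ (4 * (n + 1)) / (1 - x⁻¹ ^ 2 * (q : ℂ) ^ (4 * (n + 1))))) =
      2 * qLambert (q ^ 4 * x⁻¹ ^ 2) (q ^ 4) - 2 * qLambert (q ^ 4 * x ^ 2) (q ^ 4) := by
    rw [← h2]
    exact tsum_congr fun n => by ring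
  rw [ffun, h1', h2']
  ring

/-- The prefactor `T(x;c)` is differentiable in `c` at the critical level `c = -2`, with
derivative the Poisson structure function `f(x)` of `{t(z),t(w)}`. -/
theorem hasDerivAt_Tfun (q : ℝ) (hq0 : 0 < q) (hq1 : q < 1) (x : ℂ)
    (hx : ∀ r : ℝ, 0 ≤ r → x ^ 2 ≠ (r : ℂ)) :
    HasDerivAt (fun c : ℝ => Tfun q x c) (ffun q x) (-2) := by
  have ht := norm_ofReal_pow_lt_one hq0 hq1
  have hqc : (q : ℂ) ≠ 0 := by exact_mod_cast hq0.ne'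
  have hx0 : x ≠ 0 := by
    rintro rfl
    exact hx 0 le_rfl (by simp)
  have hx' : ∀ r : ℝ, 0 ≤ r → x⁻¹ ^ 2 ≠ r := by simpa only [inv_pow] using inv_ne_ofReal hx
  have hscale {z : ℂ} (hz : ∀ r : ℝ, 0 ≤ r → z ^ 2 ≠ r) {a : ℝ} (ha : 0 < a) (r : ℝ)
      (hr : 0 ≤ r) : (a * z) ^ 2 ≠ r := by
    simpa [mul_pow] using ofReal_mul_ne_ofReal hz (pow_pos ha 2) r hr
  set a : ℝ := q ^ ((1 : ℝ) / 2) with ha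
  have ha0 : 0 < a := Real.rpow_pos_of_pos hq0 _
  have ha2 : (a : ℂ) ^ 2 = q := by
    rw [← Complex.ofReal_pow, ha, ← Real.rpow_natCast, ← Real.rpow_mul hq0.le]
    norm_num
  have hac : (q : ℝ) ^ (-(-2) - 3 / 2 : ℝ) = a := by
    rw [ha]
    norm_num
  have hA := tauf_ne_zero hq0 hq1 (hscale hx ha0)
  have hB := tauf_ne_zero hq0 hq1 (hscale hx' ha0)
  have hT : (fun c : ℝ => Tfun q x c) = fun c : ℝ =>
      tauf q (a * x) / tauf q (a * x⁻¹) *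
        (tauf q ((q ^ (-c - 3 / 2) : ℝ) * x⁻¹) / tauf q ((q ^ (-c - 3 / 2) : ℝ) * x)) := by
    ext c
    have hs : ((q ^ (-c + 1 / 2) : ℝ) : ℂ) * x⁻¹ =
        (q : ℂ) ^ 2 * ((q ^ (-c - 3 / 2) : ℝ) * x⁻¹) := by
      rw [← mul_assoc, ← Complex.ofReal_pow, ← Complex.ofReal_mul, ← Real.rpow_natCast,
        ← Real.rpow_add hq0]
      congr 3
      push_cast
      ring
    rw [Tfun, hs, tauf_sq_mul hq0 hq1 (hscale hx' (Real.rpow_pos_of_pos hq0 _))]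
    ring
  have d (z : ℂ) (hz : ∀ r : ℝ, 0 ≤ r → z ^ 2 ≠ r) :=
    (((hasLogDerivAt_rpow hq0 (3 / 2) (-2)).const_mul z).tauf hq0 hq1
      (by rw [mul_comm, hac]; exact hscale hz ha0))
  have D := ((d x⁻¹ hx').div (d x hx) (by rwa [mul_comm, hac])).const_mul
    (tauf q (a * x) / tauf q (a * x⁻¹))
  unfold HasLogDerivAt at D
  simp only [mul_comm x⁻¹, mul_comm x, hac] at D
  rw [hT, ffun_eq_qLambert hq0 hq1]
  convert D using 1
  have c1 : (q : ℂ) ^ 3 * (a * x⁻¹)⁻¹ ^ 2 = q ^ 2 * x ^ 2 := by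
    rw [mul_inv, mul_pow, inv_pow, ha2]; field_simp
  have c2 : (q : ℂ) * (a * x⁻¹) ^ 2 = q ^ 2 * x⁻¹ ^ 2 := by rw [mul_pow, ha2]; ring
  have c3 : (q : ℂ) ^ 3 * (a * x⁻¹) ^ 2 = q ^ 4 * x⁻¹ ^ 2 := by rw [mul_pow, ha2]; ring
  have c4 : (q : ℂ) * (a * x⁻¹)⁻¹ ^ 2 = x ^ 2 := by
    rw [mul_inv, mul_pow, inv_pow, ha2]; field_simp
  have c5 : (q : ℂ) ^ 3 * (a * x)⁻¹ ^ 2 = q ^ 2 * x⁻¹ ^ 2 := by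
    rw [mul_inv, mul_pow, inv_pow, ha2]; field_simp
  have c6 : (q : ℂ) * (a * x) ^ 2 = q ^ 2 * x ^ 2 := by rw [mul_pow, ha2]; ring
  have c7 : (q : ℂ) ^ 3 * (a * x) ^ 2 = q ^ 4 * x ^ 2 := by rw [mul_pow, ha2]; ring
  have c8 : (q : ℂ) * (a * x)⁻¹ ^ 2 = x⁻¹ ^ 2 := by
    rw [mul_inv, mul_pow, inv_pow, ha2]; field_simp
  have hone : tauf q (a * x) / tauf q (a * x⁻¹) * (tauf q (a * x⁻¹) / tauf q (a * x)) = 1 := by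
    rw [div_mul_div_cancel₀ hB, div_self hA]
  rw [hone, c1, c2, c3, c4, c5, c6, c7, c8, qLambert_eq_add ht (x ^ 2),
    qLambert_eq_add ht (x⁻¹ ^ 2)]
  ring
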